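/- arXiv:1501.01020 — 7 statements merged into one kernel-verified Lean document; each statement's English description precedes it below -/
import Mathlib

section
/- For every unital C*-algebra A there exist a unital C*-algebra F and a PU-map η : A → F such that for every unital C*-algebra B and every PU-map f : A → B there is a unique unital star algebra homomorphism h : F → B with h ∘ η = f. (Equivalently: the embedding of the category of unital C*-algebras and unital star algebra homomorphisms into the category of unital C*-algebras and PU-maps has a left adjoint.) -/
/-!
Statement 0: For every unital C*-algebra `A` there exist a unital C*-algebra `F` and a
PU-map `η : A → F` such that for every unital C*-algebra `B` and every PU-map
`f : A → B` there is a unique unital star algebra homomorphism `h : F → B` with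
`h ∘ η = f`.

A PU-map is a ℂ-linear map preserving the unit which is positive; positivity refers to
the canonical order on a C*-algebra, which we encode by a `PartialOrder` instance
satisfying `StarOrderedRing` (a `Prop`-valued mixin which determines the order
uniquely from the *-ring structure).
-/

universe u

/-- A positive unital (PU) ℂ-linear map. -/
def IsPUMap {A B : Type*} [NonUnitalSemiring A] [PartialOrder A] [StarRing A] [One A]
    [NonUnitalSemiring B] [PartialOrder B] [StarRing B] [One B]
    [Module ℂ A] [Module ℂ B] (f : A →ₗ[ℂ] B) : Prop :=
  f 1 = 1 ∧ ∀ a : A, 0 ≤ a → 0 ≤ f a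


open scoped ENNReal NNReal Topology

universe v

namespace PUMIU

theorem small_closure_of_small {X : Type v} [TopologicalSpace X] [T2Space X] (s : Set X)
    [Small.{u} s] : Small.{u} (closure s) := by
  have h1 : Small.{u} (Filter s) :=
    small_of_injective (f := fun l : Filter s => (l.sets : Set (Set s)))
      (fun a b h => Filter.filter_eq h)
  refine small_of_injective
    (f := fun x : closure s => Filter.comap (Subtype.val : s → X) (𝓝 (x : X))) ?_
  intro x y hxy
  by_contra hne
  have hne' : (x : X) ≠ y := fun h => hne (Subtype.ext h)
  have hd : Disjoint (𝓝 (x : X)) (𝓝 (y : X)) := disjoint_nhds_nhds.2 hne'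
  have hd2 := Filter.disjoint_comap (m := (Subtype.val : s → X)) hd
  have hxy' : Filter.comap (Subtype.val : s → X) (𝓝 (x : X)) =
    Filter.comap (Subtype.val : s → X) (𝓝 (y : X)) := hxy
  rw [← hxy', disjoint_self] at hd2
  have := mem_closure_iff_comap_neBot.1 x.2
  exact this.ne hd2

theorem small_starAdjoin {X : Type v} [Ring X] [Algebra ℂ X]
    [StarRing X] [StarModule ℂ X] {A : Type u} (η : A → X) :
    Small.{u} (StarAlgebra.adjoin ℂ (Set.range η) : Set X) := by
  have h : (StarAlgebra.adjoin ℂ (Set.range η) : Set X) =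
      Set.range (FreeAlgebra.lift ℂ (Sum.elim η (fun a => star (η a)))) := by
    have h2 : Set.range η ∪ star (Set.range η) = Set.range (Sum.elim η (fun a => star (η a))) := by
      rw [Set.Sum.elim_range]
      congr 1
      ext x
      simp only [Set.mem_star, Set.mem_range]
      constructor
      · rintro ⟨a, ha⟩
        exact ⟨a, by rw [ha, star_star]⟩
      · rintro ⟨a, ha⟩
        exact ⟨a, by rw [← ha, star_star]⟩
    have h3 := Algebra.adjoin_range_eq_range_freeAlgebra_lift ℂ _ (Sum.elim η (fun a => star (η a)))
    rw [← h2] at h3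
    exact congrArg (fun S : Subalgebra ℂ X => (S : Set X)) h3
  rw [h]
  exact small_range _

theorem exists_transport (F' : Type v) [CStarAlgebra F'] [Small.{u} F'] :
    ∃ (F : Type u) (_ : CStarAlgebra F), Nonempty (F ≃⋆ₐ[ℂ] F') := by
  let e : Shrink.{u} F' ≃ₐ[ℂ] F' := Shrink.algEquiv ℂ F'
  let nr : NormedRing (Shrink.{u} F') := NormedRing.induced _ F' e e.injective
  let na : NormedAlgebra ℂ (Shrink.{u} F') := NormedAlgebra.induced ℂ _ F' e
  have hnorm : ∀ x, ‖e x‖ = ‖x‖ := fun x => rfl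
  let sr : StarRing (Shrink.{u} F') :=
    { star := fun x => e.symm (star (e x))
      star_involutive := fun x => by simp
      star_mul := fun x y => by simp
      star_add := fun x y => by simp }
  have hstar : ∀ x, e (star x) = star (e x) := fun x => e.apply_symm_apply _
  have hiso : Isometry e := AddMonoidHomClass.isometry_of_norm e hnorm
  have hcs : CompleteSpace (Shrink.{u} F') :=
    (completeSpace_congr (e := e.toEquiv) hiso.isUniformEmbedding).2 inferInstance
  have hC : CStarRing (Shrink.{u} F') :=
    ⟨fun x => by
      rw [← hnorm, ← hnorm (star x * x), map_mul, hstar, CStarRing.norm_star_mul_self]⟩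
  have hsm : StarModule ℂ (Shrink.{u} F') :=
    ⟨fun r x => e.injective (by rw [hstar, map_smul, map_smul, hstar, star_smul])⟩
  let cs : CStarAlgebra (Shrink.{u} F') := { }
  exact ⟨Shrink.{u} F', cs, ⟨StarAlgEquiv.ofAlgEquiv e hstar⟩⟩

structure Idx (A : Type u) [CStarAlgebra A] [PartialOrder A] [StarOrderedRing A] where
  B : Type u
  [cs : CStarAlgebra B]
  [po : PartialOrder B]
  [so : StarOrderedRing B]
  [nt : Nontrivial B]
  f : A →ₗ[ℂ] B
  pu : IsPUMap f

attribute [instance] Idx.cs Idx.po Idx.so Idx.nt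

section
variable {A : Type u} [CStarAlgebra A] [PartialOrder A] [StarOrderedRing A]

theorem norm_le_of_nonneg {B : Type*} [CStarAlgebra B] [PartialOrder B] [StarOrderedRing B]
    [Nontrivial B] (f : A →ₗ[ℂ] B) (hf : IsPUMap f) (a : A) (ha : 0 ≤ a) : ‖f a‖ ≤ ‖a‖ := by
  have := PositiveLinearMap.norm_apply_le_of_nonneg (PositiveLinearMap.mk₀ f hf.2) a ha
  have h1 : (PositiveLinearMap.mk₀ f hf.2) 1 = (1 : B) := hf.1
  rw [h1, norm_one, one_mul] at this
  exact this

theorem exists_bound (a : A) : ∃ C : ℝ, ∀ j : Idx A, ‖j.f a‖ ≤ C := by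
  have ha : a ∈ Submodule.span ℂ {a : A | 0 ≤ a} := by
    rw [CStarAlgebra.span_nonneg]; trivial
  induction ha using Submodule.span_induction with
  | mem x h => exact ⟨‖x‖, fun j => norm_le_of_nonneg j.f j.pu x h⟩
  | zero => exact ⟨0, fun j => by simp⟩
  | add x y _ _ hx hy =>
    obtain ⟨C, hC⟩ := hx
    obtain ⟨D, hD⟩ := hy
    refine ⟨C + D, fun j => ?_⟩
    rw [map_add]
    exact (norm_add_le _ _).trans (add_le_add (hC j) (hD j))
  | smul c x _ hx =>
    obtain ⟨C, hC⟩ := hx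
    refine ⟨‖c‖ * C, fun j => ?_⟩
    rw [map_smul, norm_smul]
    exact mul_le_mul_of_nonneg_left (hC j) (norm_nonneg _)

end

section
variable (A : Type u) [CStarAlgebra A] [PartialOrder A] [StarOrderedRing A]

abbrev Big : Type (u + 1) := lp (fun j : Idx A => j.B) ∞

noncomputable instance bigCStar : CStarAlgebra (Big A) where

noncomputable def bigEta : A →ₗ[ℂ] Big A where
  toFun a := ⟨fun j => j.f a, by
    obtain ⟨C, hC⟩ := exists_bound a
    exact memℓp_infty ⟨C, by rintro _ ⟨j, rfl⟩; exact hC j⟩⟩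
  map_add' a b := by
    ext j; exact map_add j.f a b
  map_smul' c a := by
    ext j; exact map_smul j.f c a

theorem bigEta_apply (a : A) (j : Idx A) : bigEta A a j = j.f a := rfl

noncomputable def bigEval (j : Idx A) : Big A →⋆ₐ[ℂ] j.B where
  toFun x := x j
  map_one' := rfl
  map_mul' _ _ := rfl
  map_zero' := rfl
  map_add' _ _ := rfl
  commutes' _ := rfl
  map_star' _ := rfl

noncomputable abbrev Med : StarSubalgebra ℂ (Big A) :=
  (StarAlgebra.adjoin ℂ (Set.range (bigEta A))).topologicalClosure

instance medClosed : IsClosed (Med A : Set (Big A)) :=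
  StarSubalgebra.isClosed_topologicalClosure _

theorem bigEta_mem (a : A) : bigEta A a ∈ Med A :=
  StarSubalgebra.le_topologicalClosure _ (StarAlgebra.subset_adjoin ℂ _ ⟨a, rfl⟩)

noncomputable def medEta : A →ₗ[ℂ] Med A where
  toFun a := ⟨bigEta A a, bigEta_mem A a⟩
  map_add' a b := Subtype.ext (map_add _ _ _)
  map_smul' c a := Subtype.ext (map_smul _ _ _)

instance medSmall : Small.{u} (Med A) := by
  have := small_starAdjoin (bigEta A)
  exact small_closure_of_small (StarAlgebra.adjoin ℂ (Set.range (bigEta A)) : Set (Big A))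

theorem nonneg_of_norm {F : Type*} [CStarAlgebra F] [PartialOrder F] [StarOrderedRing F] (x : F)
    (t : ℝ≥0) (hx : IsSelfAdjoint x) (h1 : ‖x‖ ≤ t) (h2 : ‖algebraMap ℝ F t - x‖ ≤ t) : 0 ≤ x := by
  rw [nonneg_iff_isSelfAdjoint_and_quasispectrumRestricts]
  exact ⟨hx, (SpectrumRestricts.nnreal_iff_nnnorm hx h1).2 h2⟩

theorem norm_of_nonneg {F : Type*} [CStarAlgebra F] [PartialOrder F] [StarOrderedRing F] (x : F)
    (t : ℝ≥0) (hx : 0 ≤ x) (h1 : ‖x‖ ≤ t) : ‖algebraMap ℝ F t - x‖ ≤ t := by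
  have h := nonneg_iff_isSelfAdjoint_and_quasispectrumRestricts.1 hx
  exact (SpectrumRestricts.nnreal_iff_nnnorm h.1 h1).1 h.2

theorem medEta_nonneg [PartialOrder (Med A)] [StarOrderedRing (Med A)] (a : A) (ha : 0 ≤ a) :
    0 ≤ medEta A a := by
  refine nonneg_of_norm _ ‖a‖₊ ?_ ?_ ?_
  · apply Subtype.ext
    apply lp.ext
    funext j
    exact IsSelfAdjoint.of_nonneg (j.pu.2 a ha)
  · refine lp.norm_le_of_forall_le (norm_nonneg _) fun j => ?_
    exact norm_le_of_nonneg j.f j.pu a ha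
  · refine lp.norm_le_of_forall_le (norm_nonneg _) fun j => ?_
    exact norm_of_nonneg (j.f a) ‖a‖₊ (j.pu.2 a ha) (norm_le_of_nonneg j.f j.pu a ha)

theorem medEta_one : medEta A 1 = 1 := by
  apply Subtype.ext
  apply lp.ext
  funext j
  exact j.pu.1

theorem med_ext {B : Type*} [CStarAlgebra B] (g h : Med A →⋆ₐ[ℂ] B)
    (H : ∀ a, g (medEta A a) = h (medEta A a)) : g = h := by
  have hc : ∀ k : Med A →⋆ₐ[ℂ] B, Continuous k := fun k =>
    AddMonoidHomClass.continuous_of_bound k 1 fun x => by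
      rw [one_mul]; exact NonUnitalStarAlgHom.norm_apply_le k x
  refine StarAlgHom.ext_topologicalClosure (hc g) (hc h) ?_
  apply StarAlgHom.ext_adjoin
  rintro ⟨x, hx⟩ ⟨a, rfl⟩
  exact H a

theorem med_exists {B : Type u} [CStarAlgebra B] [PartialOrder B] [StarOrderedRing B]
    (f : A →ₗ[ℂ] B) (hf : IsPUMap f) : ∃ h : Med A →⋆ₐ[ℂ] B, ∀ a, h (medEta A a) = f a := by
  cases subsingleton_or_nontrivial B with
  | inl hB =>
    refine ⟨{ toFun := fun _ => 0, map_one' := Subsingleton.elim _ _,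
              map_mul' := fun _ _ => Subsingleton.elim _ _, map_zero' := rfl,
              map_add' := fun _ _ => Subsingleton.elim _ _,
              commutes' := fun _ => Subsingleton.elim _ _,
              map_star' := fun _ => Subsingleton.elim _ _ }, fun a => Subsingleton.elim _ _⟩
  | inr hB =>
    exact ⟨(bigEval A ⟨B, f, hf⟩).comp (Med A).subtype, fun a => rfl⟩

end
end PUMIU

theorem exists_universal_arrow_from_PU_to_MIU
    (A : Type u) [CStarAlgebra A] [PartialOrder A] [StarOrderedRing A] :
    ∃ (F : Type u) (_ : CStarAlgebra F) (_ : PartialOrder F) (_ : StarOrderedRing F)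
      (η : A →ₗ[ℂ] F),
      IsPUMap η ∧
      ∀ (B : Type u) [CStarAlgebra B] [PartialOrder B] [StarOrderedRing B]
        (f : A →ₗ[ℂ] B), IsPUMap f →
        ∃! h : F →⋆ₐ[ℂ] B, ∀ a : A, h (η a) = f a := by
  obtain ⟨F, cs, ⟨e⟩⟩ := PUMIU.exists_transport.{u} (PUMIU.Med A)
  let po : PartialOrder F := CStarAlgebra.spectralOrder F
  have so : StarOrderedRing F := CStarAlgebra.spectralOrderedRing F
  let po' : PartialOrder (PUMIU.Med A) := CStarAlgebra.spectralOrder _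
  have so' : StarOrderedRing (PUMIU.Med A) := CStarAlgebra.spectralOrderedRing _
  let es : PUMIU.Med A →⋆ₐ[ℂ] F := (e.symm : PUMIU.Med A →⋆ₐ[ℂ] F)
  let et : F →⋆ₐ[ℂ] PUMIU.Med A := (e : F →⋆ₐ[ℂ] PUMIU.Med A)
  have hts : ∀ x, et (es x) = x := fun x => e.apply_symm_apply x
  have hst : ∀ x, es (et x) = x := fun x => e.symm_apply_apply x
  refine ⟨F, cs, po, so, es.toAlgHom.toLinearMap ∘ₗ PUMIU.medEta A, ⟨?_, ?_⟩, ?_⟩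
  · change es (PUMIU.medEta A 1) = 1
    rw [PUMIU.medEta_one, map_one]
  · intro a ha
    change 0 ≤ es (PUMIU.medEta A a)
    exact map_nonneg es (PUMIU.medEta_nonneg A a ha)
  · intro B _ _ _ f hf
    obtain ⟨h, hh⟩ := PUMIU.med_exists A f hf
    refine ⟨h.comp et, fun a => ?_, ?_⟩
    · change h (et (es (PUMIU.medEta A a))) = f a
      rw [hts, hh]
    · intro g hg
      have key : g.comp es = h := PUMIU.med_ext A _ _ fun a => (hg a).trans (hh a).symm
      ext x
      change g x = h (et x)
      rw [← key]
      change g x = g (es (et x))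
      rw [hst]
end

section
/- Let F : C → D be a functor with right adjoint U : D → C, and let L : Kl(UF) → D be the comparison functor from the Kleisli category of the monad UF, characterized by U ∘ L = G and L ∘ V = F. Then L is an isomorphism of categories (i.e., there is a functor K : D → Kl(UF) with K ∘ L = id and L ∘ K = id) if and only if F is bijective on objects, i.e., for every object D₀ of D there is a unique object C₀ of C with FC₀ = D₀. -/
/-!
Statement 2: Let `F : C ⥤ D` have right adjoint `U`, and let `L : Kl(UF) ⥤ D` be the
comparison functor from the Kleisli category of the monad `UF`, characterized by
`U ∘ L = G` (the forgetful functor) and `L ∘ V = F` (the free functor).  Then `L` is an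
isomorphism of categories (i.e. there is a functor `K : D ⥤ Kl(UF)` with `K ∘ L = id`
and `L ∘ K = id`) if and only if `F` is bijective on objects, i.e. for every object
`D₀` of `D` there is a unique object `C₀` of `C` with `F C₀ = D₀`.
-/

open CategoryTheory

universe v₁ v₂ u₁ u₂

/-- A fully faithful functor which is bijective on objects has a strict inverse. -/
theorem exists_strict_inverse_aux {A : Type*} {B : Type*} [Category A] [Category B]
    (L : A ⥤ B) [L.Full] [L.Faithful] (hb : Function.Bijective L.obj) :
    ∃ K : B ⥤ A, L ⋙ K = 𝟭 A ∧ K ⋙ L = 𝟭 B := by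
  choose k hk using hb.2
  let K : B ⥤ A :=
    { obj := k
      map := fun {X Y} g => L.preimage (eqToHom (hk X) ≫ g ≫ eqToHom (hk Y).symm)
      map_id := fun X => L.map_injective (by simp)
      map_comp := fun f g => L.map_injective (by simp) }
  refine ⟨K, ?_, ?_⟩
  · refine CategoryTheory.Functor.ext (fun X => hb.1 (hk _)) (fun X Y f => L.map_injective ?_)
    simp [K, eqToHom_map]
  · refine CategoryTheory.Functor.ext (fun X => hk X) (fun X Y f => ?_)
    simp [K]

/-- The comparison functor is determined on morphisms by transposition. -/
theorem comparison_transpose_aux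
    {C : Type u₁} {D : Type u₂} [Category.{v₁} C] [Category.{v₂} D]
    (F : C ⥤ D) (U : D ⥤ C) (adj : F ⊣ U)
    (L : Kleisli adj.toMonad ⥤ D)
    (hLU : L ⋙ U = Kleisli.Adjunction.fromKleisli adj.toMonad)
    (ho : ∀ X : Kleisli adj.toMonad, L.obj X = F.obj X.of)
    {X Y : Kleisli adj.toMonad} (f : X ⟶ Y) :
    adj.homEquiv X.of (F.obj Y.of)
      (eqToHom (ho X).symm ≫ L.map f ≫ eqToHom (ho Y)) = f.of := by
  have h1 : U.map (L.map f) = _ := Functor.congr_hom hLU f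
  have h2 : U.map (eqToHom (ho X).symm ≫ L.map f ≫ eqToHom (ho Y)) =
      U.map (F.map f.of) ≫ U.map (adj.counit.app (F.obj Y.of)) := by
    rw [U.map_comp, U.map_comp, h1, eqToHom_map, eqToHom_map]
    simp only [Category.assoc, eqToHom_trans, eqToHom_trans_assoc]
    erw [eqToHom_refl, eqToHom_refl, Category.id_comp, Category.comp_id]
    rfl
  rw [Adjunction.homEquiv_unit, h2]
  have h3 := adj.unit.naturality_assoc f.of (U.map (adj.counit.app (F.obj Y.of)))
  refine h3.symm.trans ?_
  erw [adj.right_triangle_components, Category.comp_id]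
  rfl

theorem kleisli_comparison_iso_iff_bijective_on_objects
    {C : Type u₁} {D : Type u₂} [Category.{v₁} C] [Category.{v₂} D]
    (F : C ⥤ D) (U : D ⥤ C) (adj : F ⊣ U)
    (L : Kleisli adj.toMonad ⥤ D)
    (hLU : L ⋙ U = Kleisli.Adjunction.fromKleisli adj.toMonad)
    (hVL : Kleisli.Adjunction.toKleisli adj.toMonad ⋙ L = F) :
    (∃ K : D ⥤ Kleisli adj.toMonad,
        L ⋙ K = 𝟭 (Kleisli adj.toMonad) ∧ K ⋙ L = 𝟭 D) ↔
      (∀ D₀ : D, ∃! C₀ : C, F.obj C₀ = D₀) := by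
  have ho : ∀ X : Kleisli adj.toMonad, L.obj X = F.obj X.of := fun X =>
    Functor.congr_obj hVL X.of
  constructor
  · rintro ⟨K, hLK, hKL⟩ D₀
    refine ⟨(K.obj D₀).of, ?_, ?_⟩
    · exact (ho _).symm.trans (Functor.congr_obj hKL D₀)
    · rintro c rfl
      have h : K.obj (L.obj (Kleisli.mk adj.toMonad c)) = Kleisli.mk adj.toMonad c :=
        Functor.congr_obj hLK _
      rw [ho] at h
      exact (congrArg Kleisli.of h).symm
  · intro hF
    have tr := @comparison_transpose_aux C D _ _ F U adj L hLU ho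
    have : L.Faithful := ⟨fun {X Y f g} h => by
      apply Kleisli.hom_ext
      rw [← tr f, ← tr g, h]⟩
    have : L.Full := ⟨fun {X Y} g => by
      let f : X ⟶ Y := Kleisli.Hom.mk
        (adj.homEquiv X.of (F.obj Y.of) (eqToHom (ho X).symm ≫ g ≫ eqToHom (ho Y)))
      refine ⟨f, ?_⟩
      have h := (adj.homEquiv _ _).injective (tr f)
      exact (cancel_mono (eqToHom (ho Y))).1 ((cancel_epi (eqToHom (ho X).symm)).1 h)⟩
    apply exists_strict_inverse_aux L
    constructor
    · intro X Y h
      rw [ho, ho] at h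
      have h' : X.of = Y.of := (hF (F.obj Y.of)).unique h rfl
      cases X
      cases Y
      cases h'
      rfl
    · intro d
      obtain ⟨c, hc, -⟩ := hF d
      exact ⟨Kleisli.mk adj.toMonad c, (ho _).trans hc⟩
end

section
/- Define ρ : ℂ² → C([0,1], ℂ) by ρ(λ, μ)(x) = λx + μ(1 − x). Then ρ is an initial arrow from ℂ² to the unital C*-algebras with respect to PU-maps: for every unital C*-algebra A and every PU-map σ : ℂ² → A there is a unique unital star algebra homomorphism τ : C([0,1], ℂ) → A such that τ ∘ ρ = σ. -/
/-!
Statement 4: Define `ρ : ℂ² → C([0,1], ℂ)` by `ρ(λ, μ)(x) = λx + μ(1 − x)`.  Then `ρ`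
is an initial arrow from `ℂ²` to the unital C*-algebras with respect to PU-maps: for
every unital C*-algebra `A` and every PU-map `σ : ℂ² → A` there is a unique unital star
algebra homomorphism `τ : C([0,1], ℂ) → A` such that `τ ∘ ρ = σ`.
-/

open scoped ComplexOrder

universe u

/-- The map `ρ : ℂ² → C([0,1], ℂ)`, `ρ(λ, μ)(x) = λ x + μ (1 − x)`. -/
noncomputable def rho : (ℂ × ℂ) →ₗ[ℂ] C(Set.Icc (0 : ℝ) 1, ℂ) where
  toFun p :=
    { toFun := fun x => p.1 * ((x : ℝ) : ℂ) + p.2 * (1 - ((x : ℝ) : ℂ))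
      continuous_toFun := by
        have h : Continuous fun x : Set.Icc (0 : ℝ) 1 => ((x : ℝ) : ℂ) :=
          Complex.continuous_ofReal.comp continuous_subtype_val
        exact (continuous_const.mul h).add
          (continuous_const.mul (continuous_const.sub h)) }
  map_add' p q := by
    ext x
    simp
    ring
  map_smul' c p := by
    ext x
    simp
    ring

theorem rho_decomp (p : ℂ × ℂ) : rho p = p.2 • 1 + (p.1 - p.2) • rho (1, 0) := by
  ext x
  simp [rho]
  ring

open scoped CStarAlgebra in
theorem rho_hom_ext (A : Type u) [CStarAlgebra A]
    (φ ψ : C(Set.Icc (0 : ℝ) 1, ℂ) →⋆ₐ[ℂ] A) (h : φ (rho (1, 0)) = ψ (rho (1, 0))) :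
    φ = ψ := by
  have hφ : Continuous φ := map_continuous φ
  have hψ : Continuous ψ := map_continuous ψ
  have hle : StarAlgebra.adjoin ℂ {rho (1, 0)} ≤ StarAlgHom.equalizer φ ψ :=
    StarAlgHom.adjoin_le_equalizer φ ψ (by simpa using h)
  have htop := ContinuousMap.starSubalgebra_topologicalClosure_eq_top_of_separatesPoints
    (StarAlgebra.adjoin ℂ {rho (1, 0)}) (by
      intro x y hxy
      refine ⟨_, ⟨rho (1, 0), StarAlgebra.subset_adjoin _ _ rfl, rfl⟩, ?_⟩
      intro hc
      apply hxy
      simpa [rho, Subtype.ext_iff] using hc)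
  have hcl := StarSubalgebra.topologicalClosure_minimal hle
    (isClosed_eq hφ hψ)
  rw [htop] at hcl
  ext1 f
  exact hcl (StarSubalgebra.mem_top (x := f))

theorem rho_initial_arrow
    (A : Type u) [CStarAlgebra A] [PartialOrder A] [StarOrderedRing A]
    (σ : (ℂ × ℂ) →ₗ[ℂ] A) (hσ1 : σ 1 = 1) (hσpos : ∀ p : ℂ × ℂ, 0 ≤ p → 0 ≤ σ p) :
    ∃! τ : C(Set.Icc (0 : ℝ) 1, ℂ) →⋆ₐ[ℂ] A, ∀ p : ℂ × ℂ, τ (rho p) = σ p := by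
  have hσ : ∀ p : ℂ × ℂ, σ p = p.2 • 1 + (p.1 - p.2) • σ (1, 0) := by
    intro p
    rw [← hσ1, ← map_smul, ← map_smul, ← map_add]
    congr 1
    ext <;> simp
  have h0 : 0 ≤ σ (1, 0) := hσpos _ (by simp [Prod.le_def])
  have h1 : σ (1, 0) ≤ 1 := by
    have h := hσpos (0, 1) (by simp [Prod.le_def])
    rw [hσ] at h
    simpa [← sub_eq_add_neg] using h
  generalize σ (1, 0) = a at hσ h0 h1
  have hsa : IsSelfAdjoint a := .of_nonneg h0
  have hspec : ∀ z ∈ spectrum ℂ a, z.re ∈ Set.Icc (0 : ℝ) 1 := by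
    intro z hz
    have hz' : z.re ∈ spectrum ℝ a := by
      rw [hsa.mem_spectrum_eq_re hz] at hz
      exact spectrum.of_algebraMap_mem ℂ hz
    refine ⟨spectrum_nonneg_of_nonneg h0 hz', ?_⟩
    have h1' : a ≤ algebraMap ℝ A 1 := by simpa using h1
    exact (le_algebraMap_iff_spectrum_le (R := ℝ) hsa).1 h1' _ hz'
  let g : C(spectrum ℂ a, Set.Icc (0 : ℝ) 1) :=
    ⟨fun z => ⟨(z : ℂ).re, hspec z z.2⟩, by fun_prop⟩
  have hn : IsStarNormal a := hsa.isStarNormal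
  let τ : C(Set.Icc (0 : ℝ) 1, ℂ) →⋆ₐ[ℂ] A :=
    (cfcHom (R := ℂ) hn).comp (ContinuousMap.compStarAlgHom' ℂ ℂ g)
  have hX : τ (rho (1, 0)) = a := by
    have : (rho (1, 0)).comp g = (ContinuousMap.id ℂ).restrict (spectrum ℂ a) := by
      ext z
      simpa [rho, g] using (hsa.mem_spectrum_eq_re z.2).symm
    change cfcHom (R := ℂ) hn ((rho (1, 0)).comp g) = a
    rw [this]
    exact cfcHom_id hn
  refine ⟨τ, fun p => ?_, fun τ' h' => ?_⟩
  · rw [rho_decomp, hσ, map_add, map_smul, map_smul, map_one, hX]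
  · apply rho_hom_ext
    rw [hX, h', hσ]
    simp
end

section
/- Let B be a unital C*-algebra and ρ : ℂ³ → B a PU-map which is an initial arrow from ℂ³ to the unital C*-algebras with respect to PU-maps, i.e., for every unital C*-algebra A and every PU-map f : ℂ³ → A there is a unique unital star algebra homomorphism h : B → A with h ∘ ρ = f. Then B is not commutative. -/
/-!
Statement 5: Let `B` be a unital C*-algebra and `ρ : ℂ³ → B` a PU-map which is an
initial arrow from `ℂ³` to the unital C*-algebras with respect to PU-maps, i.e. for
every unital C*-algebra `A` and every PU-map `f : ℂ³ → A` there is a unique unital star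
algebra homomorphism `h : B → A` with `h ∘ ρ = f`.  Then `B` is not commutative.
-/

open scoped ComplexOrder

universe u

section aux
open CStarMatrix

def projP : CStarMatrix (PUnit.{u+1} ⊕ PUnit.{u+1}) (PUnit.{u+1} ⊕ PUnit.{u+1}) ℂ :=
  CStarMatrix.ofMatrix (Matrix.of (fun i j => if i.isLeft && j.isLeft then 1 else 0))

noncomputable def projQ : CStarMatrix (PUnit.{u+1} ⊕ PUnit.{u+1}) (PUnit.{u+1} ⊕ PUnit.{u+1}) ℂ :=
  CStarMatrix.ofMatrix (Matrix.of (fun _ _ => 1/2))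

lemma projP_sa : star projP.{u} = projP := by
  ext i j
  rcases i with i | i <;> rcases j with j | j <;>
    simp [projP, CStarMatrix.star_eq_conjTranspose]

lemma projQ_sa : star projQ.{u} = projQ := by
  ext i j
  simp [projQ, CStarMatrix.star_eq_conjTranspose]

lemma projP_idem : projP.{u} * projP = projP := by
  ext i j
  rcases i with i | i <;> rcases j with j | j <;>
    simp [projP, CStarMatrix.mul_apply]

lemma projQ_idem : projQ.{u} * projQ = projQ := by
  ext i j
  simp [projQ, CStarMatrix.mul_apply]
  try norm_num

lemma proj_not_comm : projP.{u} * projQ ≠ projQ * projP := by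
  intro h
  have := congrFun (congrFun h (Sum.inl PUnit.unit)) (Sum.inr PUnit.unit)
  simp [projP, projQ, CStarMatrix.mul_apply] at this

end aux

lemma smul_proj_nonneg {A : Type u} [CStarAlgebra A] [PartialOrder A] [StarOrderedRing A]
    (p : A) (hs : star p = p) (hi : p * p = p) (a : ℂ) (ha : 0 ≤ a) : 0 ≤ a • p := by
  have hp : 0 ≤ p := by
    have := star_mul_self_nonneg p
    rwa [hs, hi] at this
  exact smul_nonneg ha hp

lemma exists_PU {A : Type u} [CStarAlgebra A] [PartialOrder A] [StarOrderedRing A]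
    (p q : A) (hs : star p = p) (hi : p * p = p) (hs' : star q = q) (hi' : q * q = q) :
    ∃ f : (ℂ × ℂ × ℂ) →ₗ[ℂ] A, f 1 = 1 ∧ (∀ x : ℂ × ℂ × ℂ, 0 ≤ x → 0 ≤ f x) ∧
      f (2, 0, 0) = p ∧ f (0, 2, 0) = q := by
  have e : ∀ r : A, star r = r → r * r = r → star (1 - r) = 1 - r ∧ (1 - r) * (1 - r) = 1 - r := by
    intro r h1 h2
    refine ⟨by rw [star_sub, star_one, h1], ?_⟩
    rw [mul_sub, sub_mul, sub_mul, h2]; simp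
  have key : ∀ a : ℂ, 0 ≤ a → 0 ≤ a * (1/2) := fun a ha =>
    mul_nonneg ha (by norm_num [Complex.le_def])
  refine ⟨(LinearMap.fst ℂ ℂ (ℂ × ℂ)).smulRight ((1/2 : ℂ) • p) +
    ((LinearMap.fst ℂ ℂ ℂ).comp (LinearMap.snd ℂ ℂ (ℂ × ℂ))).smulRight ((1/2 : ℂ) • q) +
    ((LinearMap.snd ℂ ℂ ℂ).comp (LinearMap.snd ℂ ℂ (ℂ × ℂ))).smulRight
      ((1/2 : ℂ) • (1 - p) + (1/2 : ℂ) • (1 - q)), ?_, ?_, ?_, ?_⟩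
  · simp
    module
  · rintro ⟨a, b, c⟩ ⟨ha, hb, hc⟩
    simp only [LinearMap.add_apply, LinearMap.smulRight_apply, LinearMap.comp_apply,
      LinearMap.fst_apply, LinearMap.snd_apply, smul_add, smul_smul]
    exact add_nonneg (add_nonneg (smul_proj_nonneg p hs hi _ (key a ha))
      (smul_proj_nonneg q hs' hi' _ (key b hb)))
      (add_nonneg (smul_proj_nonneg _ (e p hs hi).1 (e p hs hi).2 _ (key c hc))
       (smul_proj_nonneg _ (e q hs' hi').1 (e q hs' hi').2 _ (key c hc)))
  · simp
  · simp

theorem not_commutative_of_initial_arrow_from_C3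
    (B : Type u) [CStarAlgebra B] [PartialOrder B] [StarOrderedRing B]
    (ρ : (ℂ × ℂ × ℂ) →ₗ[ℂ] B) (hρ1 : ρ 1 = 1)
    (hρpos : ∀ p : ℂ × ℂ × ℂ, 0 ≤ p → 0 ≤ ρ p)
    (huniv : ∀ (A : Type u) [CStarAlgebra A] [PartialOrder A] [StarOrderedRing A]
      (f : (ℂ × ℂ × ℂ) →ₗ[ℂ] A), f 1 = 1 → (∀ p : ℂ × ℂ × ℂ, 0 ≤ p → 0 ≤ f p) →
      ∃! h : B →⋆ₐ[ℂ] A, ∀ p : ℂ × ℂ × ℂ, h (ρ p) = f p) :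
    ¬ (∀ x y : B, x * y = y * x) := by
  intro hc
  letI : PartialOrder (CStarMatrix (PUnit.{u+1} ⊕ PUnit.{u+1}) (PUnit.{u+1} ⊕ PUnit.{u+1}) ℂ) :=
    CStarAlgebra.spectralOrder _
  haveI : StarOrderedRing
      (CStarMatrix (PUnit.{u+1} ⊕ PUnit.{u+1}) (PUnit.{u+1} ⊕ PUnit.{u+1}) ℂ) :=
    CStarAlgebra.spectralOrderedRing _
  obtain ⟨f, h1, hpos, hp, hq⟩ := exists_PU projP.{u} projQ projP_sa projP_idem projQ_sa projQ_idem
  obtain ⟨h, hh, -⟩ := huniv _ f h1 hpos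
  apply proj_not_comm.{u}
  rw [← hp, ← hq, ← hh, ← hh, ← map_mul h, hc, map_mul h]
end

section
/- Let T : A → B be a PU-map between unital C*-algebras. Then T is a MIU-map (i.e., T is multiplicative and star-preserving, hence a unital star algebra homomorphism) if and only if T preserves covariance, that is, for every PU-map φ : B → ℂ and all a, b ∈ A one has Cov_φ(Ta, Tb) = Cov_{φ∘T}(a, b), where Cov_ψ(x, y) := ψ(x*y) − ψ(x)* · ψ(y). -/
/-!
Statement 12: Let `T : A → B` be a PU-map between unital C*-algebras.  Then `T` is a
MIU-map (multiplicative and star-preserving, hence a unital star algebra homomorphism)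
if and only if `T` preserves covariance: for every PU-map (state) `φ : B → ℂ` and all
`a b : A` one has `Cov φ (T a) (T b) = Cov (φ ∘ T) a b`, where
`Cov ψ x y := ψ (x* y) − ψ(x)* ⬝ ψ(y)`.
-/

open scoped ComplexOrder

universe u

/-- The covariance of `x` and `y` in the state `ψ`:  `Cov ψ x y = ψ (x* y) − ψ(x)* ψ(y)`. -/
noncomputable def covariance {A : Type*} [NonUnitalSemiring A] [StarRing A] [Module ℂ A]
    (ψ : A →ₗ[ℂ] ℂ) (x y : A) : ℂ :=
  ψ (star x * y) - star (ψ x) * ψ y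

open ComplexStarModule in
/-- If every state vanishes on `b`, then the real part of `b` is positive. -/
lemma realPart_nonneg_of_states {B : Type*} [CStarAlgebra B] [PartialOrder B] [StarOrderedRing B]
    (b : B) (h : ∀ φ : B →ₗ[ℂ] ℂ, φ 1 = 1 → (∀ b : B, 0 ≤ b → 0 ≤ φ b) → φ b = 0) :
    0 ≤ ((ℜ b : selfAdjoint B) : B) := by
  by_contra hb
  obtain ⟨f, hf, hf0⟩ := (ProperCone.positive ℝ B).hyperplane_separation_point
    (x₀ := ((ℜ b : selfAdjoint B) : B)) (by simpa using hb)
  have hf' : ∀ x : B, 0 ≤ x → 0 ≤ f x := fun x hx => hf x (by simpa using hx)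
  have h1 : 0 < f 1 := by
    have hle := IsSelfAdjoint.neg_algebraMap_norm_le_self (a := ((ℜ b : selfAdjoint B) : B))
      (ℜ b).property
    have h2 := hf' _ (sub_nonneg.2 hle)
    rw [sub_neg_eq_add, Algebra.algebraMap_eq_smul_one, map_add, map_smul, smul_eq_mul] at h2
    by_contra hc
    have h3 := hf' 1 zero_le_one
    have h4 : f 1 = 0 := le_antisymm (not_lt.1 hc) h3
    rw [h4] at h2
    linarith
  let g : Module.Dual ℝ B :=
    f.toLinearMap ∘ₗ (selfAdjoint.submodule ℝ B).subtype ∘ₗ (realPart (A := B))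
  have hg : ∀ x : B, g x = f ((ℜ x : selfAdjoint B) : B) := fun x => rfl
  let G : B →ₗ[ℂ] ℂ := Module.Dual.extendRCLike (𝕜 := ℂ) g
  have hG : ∀ x : B, G x = (g x : ℂ) - Complex.I * (g (Complex.I • x) : ℂ) := fun x => rfl
  have hsa : ∀ x : B, IsSelfAdjoint x → G x = (f x : ℂ) := by
    intro x hx
    rw [hG, hg, hg, realPart_I_smul, hx.imaginaryPart, hx.coe_realPart]
    simp
  have h0 := h (((f 1 : ℂ))⁻¹ • G) ?_ ?_
  · have h1' : (f 1 : ℂ) ≠ 0 := by exact_mod_cast h1.ne'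
    rw [LinearMap.smul_apply, smul_eq_mul, mul_eq_zero] at h0
    have h5 : G b = 0 := h0.resolve_left (inv_ne_zero h1')
    have h6 := congrArg Complex.re h5
    rw [hG] at h6
    simp [hg] at h6
    linarith
  · have h1' : (f 1 : ℂ) ≠ 0 := by exact_mod_cast h1.ne'
    rw [LinearMap.smul_apply, smul_eq_mul, hsa 1 (IsSelfAdjoint.one B), inv_mul_cancel₀ h1']
  · intro x hx
    rw [LinearMap.smul_apply, smul_eq_mul, hsa x (IsSelfAdjoint.of_nonneg hx)]
    have : 0 ≤ (f 1)⁻¹ * f x := mul_nonneg (inv_nonneg.2 h1.le) (hf' x hx)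
    exact_mod_cast this

open ComplexStarModule in
/-- States separate the points of a unital C*-algebra. -/
lemma eq_zero_of_states {B : Type*} [CStarAlgebra B] [PartialOrder B] [StarOrderedRing B]
    (b : B) (h : ∀ φ : B →ₗ[ℂ] ℂ, φ 1 = 1 → (∀ b : B, 0 ≤ b → 0 ≤ φ b) → φ b = 0) :
    b = 0 := by
  have key : ∀ c : ℂ, 0 ≤ ((ℜ (c • b) : selfAdjoint B) : B) := fun c =>
    realPart_nonneg_of_states _ fun φ h1 h2 => by rw [map_smul, h φ h1 h2, smul_zero]
  have e1 := key 1
  have e2 := key (-1)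
  have e3 := key Complex.I
  have e4 := key (-Complex.I)
  simp only [neg_smul, one_smul, map_neg, realPart_I_smul, neg_neg, NegMemClass.coe_neg,
    Left.nonneg_neg_iff] at e1 e2 e3 e4
  rw [← realPart_add_I_smul_imaginaryPart b, le_antisymm e2 e1, le_antisymm e3 e4]
  simp

theorem PU_is_MIU_iff_preserves_covariance
    {A B : Type u} [CStarAlgebra A] [PartialOrder A] [StarOrderedRing A]
    [CStarAlgebra B] [PartialOrder B] [StarOrderedRing B]
    (T : A →ₗ[ℂ] B) (hT1 : T 1 = 1) (hTpos : ∀ a : A, 0 ≤ a → 0 ≤ T a) :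
    ((∀ x y : A, T (x * y) = T x * T y) ∧ (∀ x : A, T (star x) = star (T x))) ↔
      (∀ φ : B →ₗ[ℂ] ℂ, φ 1 = 1 → (∀ b : B, 0 ≤ b → 0 ≤ φ b) →
        ∀ a b : A, covariance φ (T a) (T b) = covariance (φ ∘ₗ T) a b) := by
  constructor
  · rintro ⟨hm, hs⟩ φ - - a b
    simp [covariance, hm, hs]
  · intro h
    have key : ∀ a b : A, T (star a * b) = star (T a) * T b := by
      intro a b
      rw [← sub_eq_zero]
      refine eq_zero_of_states _ fun φ h1 h2 => ?_
      have := h φ h1 h2 a b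
      simp only [covariance, LinearMap.comp_apply, sub_left_inj] at this
      rw [map_sub, this, sub_self]
    have hs : ∀ x : A, T (star x) = star (T x) := fun x => by
      simpa [hT1] using key x 1
    refine ⟨fun x y => ?_, hs⟩
    have := key (star x) y
    rwa [star_star, hs, star_star] at this
end

section
/- Let I be a set and for each i ∈ I let A_i be a unital C*-algebra, and suppose that the set { i ∈ I : A_i is nontrivial } is infinite (A_i is nontrivial when 0 ≠ 1 in A_i). Then there is no norm on the full cartesian product Π_{i∈I} A_i (with coordinatewise operations) making it a unital C*-algebra, i.e., a complete normed star ring satisfying the C*-identity ‖a*a‖ = ‖a‖². -/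
/-!
Statement 15: Let `I` be a set and for each `i ∈ I` let `A i` be a unital C*-algebra,
and suppose that `{i | A i is nontrivial}` is infinite.  Then there is no norm on the
full cartesian product `∀ i, A i` (with coordinatewise operations) making it a unital
C*-algebra, i.e. a complete normed star ring satisfying the C*-identity
`‖a* a‖ = ‖a‖²`.  (We quantify over norm functions `nrm : (∀ i, A i) → ℝ` that are
definite, subadditive, submultiplicative, ℂ-homogeneous, satisfy the C*-identity and
are sequentially complete, with respect to the coordinatewise *-algebra structure.)
-/

universe u v

theorem no_cstar_norm_on_pi_of_infinitely_many_nontrivial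
    (I : Type v) (A : I → Type u) [∀ i, CStarAlgebra (A i)]
    (hinf : {i : I | (0 : A i) ≠ 1}.Infinite) :
    ¬ ∃ nrm : (∀ i, A i) → ℝ,
        (∀ a, nrm a = 0 ↔ a = 0) ∧
        (∀ a b, nrm (a + b) ≤ nrm a + nrm b) ∧
        (∀ a b, nrm (a * b) ≤ nrm a * nrm b) ∧
        (∀ (c : ℂ) a, nrm (c • a) = ‖c‖ * nrm a) ∧
        (∀ a, nrm (star a * a) = nrm a ^ 2) ∧
        (∀ u : ℕ → ∀ i, A i,
          (∀ ε : ℝ, 0 < ε → ∃ N, ∀ m ≥ N, ∀ n ≥ N, nrm (u m - u n) < ε) →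
          ∃ L : ∀ i, A i, ∀ ε : ℝ, 0 < ε → ∃ N, ∀ n ≥ N, nrm (u n - L) < ε) := by
  classical
  rintro ⟨nrm, hzero, hadd, hmul, hsmul, -, -⟩
  have hnonneg : ∀ a, 0 ≤ nrm a := by
    intro a
    have h1 := hadd a ((-1 : ℂ) • a)
    have h2 := hsmul (-1) a
    have h3 : a + (-1 : ℂ) • a = 0 := by simp
    rw [h3, (hzero 0).2 rfl, h2] at h1
    simp at h1
    linarith
  -- an injective sequence of nontrivial indices
  let f : ℕ → I := fun n => (hinf.natEmbedding _ n : I)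
  have hf : Function.Injective f := fun m n h =>
    (hinf.natEmbedding _).injective (Subtype.ext h)
  have hne : ∀ n, (0 : A (f n)) ≠ 1 := fun n => (hinf.natEmbedding _ n).2
  -- an unbounded element
  let a : ∀ i, A i := fun i => ((Function.invFun f i : ℕ) : ℂ) • (1 : A i)
  have key : ∀ n : ℕ, (n : ℝ) ≤ nrm a := by
    intro n
    let e : ∀ i, A i := Pi.single (f n) 1
    have he : e ≠ 0 := by
      intro h
      have h' := congrFun h (f n)
      simp only [e, Pi.single_eq_same, Pi.zero_apply] at h'
      exact hne n h'.symm
    have hepos : 0 < nrm e :=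
      lt_of_le_of_ne (hnonneg e) (fun h => he ((hzero e).1 h.symm))
    have hae : a * e = (n : ℂ) • e := by
      funext i
      by_cases hi : i = f n
      · subst hi
        simp [a, e, Function.leftInverse_invFun hf n]
      · simp [e, Pi.single_eq_of_ne hi]
    have h := hmul a e
    rw [hae, hsmul] at h
    simp only [Complex.norm_natCast] at h
    exact le_of_mul_le_mul_right h hepos
  obtain ⟨n, hn⟩ := exists_nat_gt (nrm a)
  exact absurd (key n) (not_le.2 hn)
end

section
/- For every unital C*-algebra A there exist a unital C*-algebra F and a PsU-map η : A → F such that for every unital C*-algebra B and every PsU-map f : A → B there is a unique unital star algebra homomorphism h : F → B with h ∘ η = f. (Equivalently: the embedding of the category of unital C*-algebras and unital star algebra homomorphisms into the category of unital C*-algebras and PsU-maps has a left adjoint.) -/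
universe u

/-- A positive subunital (PsU) ℂ-linear map. -/
def IsPsUMap {A B : Type*} [NonUnitalSemiring A] [PartialOrder A] [StarRing A] [One A]
    [NonUnitalSemiring B] [PartialOrder B] [StarRing B] [One B]
    [Module ℂ A] [Module ℂ B] (f : A →ₗ[ℂ] B) : Prop :=
  f 1 ≤ 1 ∧ ∀ a : A, 0 ≤ a → 0 ≤ f a

open scoped ENNReal NNReal

namespace PsUAux

/-- `ℓ^∞`-products of nontrivial unital C*-algebras, abstractly. -/
theorem exists_product {I : Type u} (E : I → Type u) [∀ i, CStarAlgebra (E i)]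
    [∀ i, Nontrivial (E i)] :
    ∃ (P : Type u) (_ : CStarAlgebra P) (π : ∀ i, P →⋆ₐ[ℂ] E i),
      (∀ (x : P) (c : ℝ), 0 ≤ c → (∀ i, ‖π i x‖ ≤ c) → ‖x‖ ≤ c) ∧
      (∀ (x : P) (i : I), ‖π i x‖ ≤ ‖x‖) ∧
      (∀ (y : ∀ i, E i) (c : ℝ), (∀ i, ‖y i‖ ≤ c) → ∃ x : P, ∀ i, π i x = y i) := by
  let : CStarAlgebra (lp E ∞) :=
    { (inferInstance : NormedRing (lp E ∞)), lp.inftyStarRing, lp.inftyNormedAlgebra (𝕜 := ℂ) (B := E),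
      lp.inftyCStarRing (B := E) with
      toCompleteSpace := inferInstance
      star_smul := star_smul }
  refine ⟨lp E ∞, inferInstance, fun i =>
    { toFun := fun x => x i
      map_one' := rfl
      map_mul' := fun _ _ => rfl
      map_zero' := rfl
      map_add' := fun _ _ => rfl
      commutes' := fun _ => rfl
      map_star' := fun _ => rfl }, ?_, ?_, ?_⟩
  · intro x c hc h
    exact lp.norm_le_of_forall_le hc h
  · intro x i
    exact lp.norm_apply_le_norm (by simp) x i
  · intro y c h
    exact ⟨⟨y, memℓp_infty ⟨c, by rintro _ ⟨i, rfl⟩; exact h i⟩⟩, fun i => rfl⟩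

theorem nonneg_iff_norm {B : Type*} [CStarAlgebra B] [PartialOrder B] [StarOrderedRing B]
    {a : B} {t : ℝ} (ht : ‖a‖ ≤ t) :
    0 ≤ a ↔ IsSelfAdjoint a ∧ ‖algebraMap ℂ B t - a‖ ≤ t := by
  lift t to ℝ≥0 using (norm_nonneg a).trans ht
  rw [nonneg_iff_isSelfAdjoint_and_quasispectrumRestricts]
  refine and_congr_right fun ha => ?_
  exact SpectrumRestricts.nnreal_iff_nnnorm ha (t := t) (by exact_mod_cast ht)

section
variable {A B : Type*} [CStarAlgebra A] [PartialOrder A] [StarOrderedRing A]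
  [CStarAlgebra B] [PartialOrder B] [StarOrderedRing B]

theorem map_star' (f : A →ₗ[ℂ] B) (hf : IsPsUMap f) (a : A) : f (star a) = star (f a) := by
  obtain ⟨y, hy, -, h⟩ := CStarAlgebra.exists_sum_four_nonneg a
  have h1 : ∀ i, star (y i) = y i := fun i => (IsSelfAdjoint.of_nonneg (hy i)).star_eq
  have h2 : ∀ i, star (f (y i)) = f (y i) :=
    fun i => (IsSelfAdjoint.of_nonneg (hf.2 _ (hy i))).star_eq
  rw [h]
  simp only [star_sum, map_sum, star_smul, map_smul, h1, h2]

theorem norm_le (f : A →ₗ[ℂ] B) (hf : IsPsUMap f) (a : A) : ‖f a‖ ≤ 4 * ‖a‖ := by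
  obtain ⟨y, hy, hn, h⟩ := CStarAlgebra.exists_sum_four_nonneg a
  have h1 : ‖f 1‖ ≤ 1 := CStarAlgebra.norm_le_one_iff_of_nonneg _ (hf.2 1 zero_le_one) |>.2 hf.1
  have key : ∀ i, ‖f (y i)‖ ≤ ‖a‖ := fun i => by
    have := (PositiveLinearMap.mk₀ f hf.2).norm_apply_le_of_nonneg (y i) (hy i)
    calc ‖f (y i)‖ ≤ ‖f 1‖ * ‖y i‖ := this
      _ ≤ 1 * ‖a‖ := mul_le_mul h1 (hn i) (norm_nonneg _) zero_le_one
      _ = ‖a‖ := one_mul _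
  conv_lhs => rw [h]
  simp only [map_sum, map_smul]
  refine (norm_sum_le _ _).trans ?_
  simp only [norm_smul, norm_pow, Complex.norm_I, one_pow, one_mul]
  refine (Finset.sum_le_sum fun i _ => key i).trans ?_
  simp

end

/-- PsU maps out of `A` into nontrivial algebras. -/
structure Obj (A : Type u) [CStarAlgebra A] [PartialOrder A] [StarOrderedRing A] where
  B : Type u
  [c : CStarAlgebra B]
  [p : PartialOrder B]
  [s : StarOrderedRing B]
  [n : Nontrivial B]
  f : A →ₗ[ℂ] B
  hf : IsPsUMap f

attribute [instance] Obj.c Obj.p Obj.s Obj.n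

/-- The seminorm on the free algebra induced by a PsU map. -/
noncomputable def sn {A : Type u} [CStarAlgebra A] [PartialOrder A] [StarOrderedRing A]
    (o : Obj A) (x : FreeAlgebra ℂ A) : ℝ := ‖FreeAlgebra.lift ℂ o.f x‖

/-- A weakly universal product over a small family. -/
theorem exists_weak (A : Type u) [CStarAlgebra A] [PartialOrder A] [StarOrderedRing A] :
    ∃ (P : Type u) (_ : CStarAlgebra P) (η : A →ₗ[ℂ] P),
      (∀ a, η (star a) = star (η a)) ∧
      (∀ a, 0 ≤ a → ‖algebraMap ℂ P (4 * ‖a‖ : ℝ) - η a‖ ≤ 4 * ‖a‖) ∧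
      (∀ a, ‖η a‖ ≤ 4 * ‖a‖) ∧
      ‖algebraMap ℂ P (5 : ℝ) - (1 - η 1)‖ ≤ 5 ∧ ‖1 - η 1‖ ≤ 5 ∧
      ∀ (B : Type u) [CStarAlgebra B] [PartialOrder B] [StarOrderedRing B]
        (f : A →ₗ[ℂ] B), IsPsUMap f → ∀ x : FreeAlgebra ℂ A,
          ‖FreeAlgebra.lift ℂ f x‖ ≤ ‖FreeAlgebra.lift ℂ η x‖ := by
  let I : Type u := Set.range (sn (A := A))
  let o : I → Obj A := fun i => i.2.choose
  have ho : ∀ i : I, sn (o i) = i.1 := fun i => i.2.choose_spec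
  obtain ⟨P, cP, π, h1, h2, h3⟩ := exists_product (fun i => (o i).B)
  have inj : ∀ x y : P, (∀ i, π i x = π i y) → x = y := fun x y h => by
    have := h1 (x - y) 0 le_rfl (fun i => by simp [h i])
    exact sub_eq_zero.1 (norm_le_zero_iff.1 this)
  choose η hη using fun a : A => h3 (fun i => (o i).f a) (4 * ‖a‖) (fun i => norm_le _ (o i).hf a)
  let η' : A →ₗ[ℂ] P :=
    { toFun := η
      map_add' := fun a b => inj _ _ fun i => by simp [hη]
      map_smul' := fun a b => inj _ _ fun i => by simp [hη] }
  have hη' : ∀ a i, π i (η' a) = (o i).f a := hη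
  have halg : ∀ (i) (z : ℂ), π i (algebraMap ℂ P z) = algebraMap ℂ _ z := fun i z =>
    AlgHomClass.commutes (π i) z
  have hone : ∀ i, ‖1 - (o i).f 1‖ ≤ 5 := fun i => by
    have e : ‖(1 : A)‖ ≤ 1 := by
      rcases subsingleton_or_nontrivial A with h | h
      · simp [Subsingleton.elim (1 : A) 0]
      · simp
    have := norm_le _ (o i).hf 1
    have h' := norm_sub_le (1 : (o i).B) ((o i).f 1)
    rw [norm_one] at h'
    linarith
  refine ⟨P, cP, η', ?_, ?_, ?_, ?_, ?_, ?_⟩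
  · intro a
    refine inj _ _ fun i => ?_
    rw [hη', map_star (π i), hη', map_star' _ (o i).hf]
  · intro a ha
    refine h1 _ _ (by positivity) fun i => ?_
    rw [map_sub, halg, hη']
    exact ((nonneg_iff_norm (norm_le _ (o i).hf a)).1 ((o i).hf.2 a ha)).2
  · intro a
    refine h1 _ _ (by positivity) fun i => ?_
    rw [hη']
    exact norm_le _ (o i).hf a
  · refine h1 _ _ (by positivity) fun i => ?_
    rw [map_sub, map_sub, halg, hη', map_one]
    exact ((nonneg_iff_norm (hone i)).1 (sub_nonneg.2 (o i).hf.1)).2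
  · refine h1 _ _ (by positivity) fun i => ?_
    rw [map_sub, hη', map_one]
    exact hone i
  · intro B _ _ _ f hf x
    rcases subsingleton_or_nontrivial B with h | h
    · rw [Subsingleton.elim (FreeAlgebra.lift ℂ f x) 0, norm_zero]
      exact norm_nonneg _
    · let q : Obj A := ⟨B, f, hf⟩
      let i : I := ⟨sn q, q, rfl⟩
      have e1 : ‖FreeAlgebra.lift ℂ f x‖ = ‖FreeAlgebra.lift ℂ (o i).f x‖ :=
        (congrFun (ho i) x).symm
      have e2 : ((π i : P →ₐ[ℂ] (o i).B).comp (FreeAlgebra.lift ℂ η')) =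
          FreeAlgebra.lift ℂ (o i).f := by
        ext a
        simp [hη']
      rw [e1, ← e2]
      exact h2 _ i

end PsUAux

open PsUAux in
theorem exists_universal_arrow_from_PsU_to_MIU
    (A : Type u) [CStarAlgebra A] [PartialOrder A] [StarOrderedRing A] :
    ∃ (F : Type u) (_ : CStarAlgebra F) (_ : PartialOrder F) (_ : StarOrderedRing F)
      (η : A →ₗ[ℂ] F),
      IsPsUMap η ∧
      ∀ (B : Type u) [CStarAlgebra B] [PartialOrder B] [StarOrderedRing B]
        (f : A →ₗ[ℂ] B), IsPsUMap f →
        ∃! h : F →⋆ₐ[ℂ] B, ∀ a : A, h (η a) = f a := by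
  obtain ⟨P, cP, η, hstar, hpos, hbd, hone, hone', huniv⟩ := exists_weak A
  let L := FreeAlgebra.lift ℂ (η : A → P)
  have hL : ∀ a, L (FreeAlgebra.ι ℂ a) = η a := fun a => by simp [L]
  have hLstar : ∀ x, ∃ y, L y = star (L x) := by
    intro x
    induction x using FreeAlgebra.induction with
    | grade0 r => exact ⟨algebraMap _ _ (star r), by
        rw [AlgHom.commutes, AlgHom.commutes, algebraMap_star_comm]⟩
    | grade1 a => exact ⟨FreeAlgebra.ι ℂ (star a), by rw [hL, hL, hstar]⟩
    | mul a b ha hb =>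
      obtain ⟨y, hy⟩ := ha
      obtain ⟨z, hz⟩ := hb
      exact ⟨z * y, by simp [hy, hz]⟩
    | add a b ha hb =>
      obtain ⟨y, hy⟩ := ha
      obtain ⟨z, hz⟩ := hb
      exact ⟨y + z, by simp [hy, hz]⟩
  let S : StarSubalgebra ℂ P :=
    { L.range with
      star_mem' := by
        rintro _ ⟨x, rfl⟩
        obtain ⟨y, hy⟩ := hLstar x
        exact ⟨y, hy⟩ }
  let F := S.topologicalClosure
  have : IsClosed (F : Set P) := S.isClosed_topologicalClosure
  have hLF : ∀ x, L x ∈ F := fun x => S.le_topologicalClosure ⟨x, rfl⟩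
  let : PartialOrder F := CStarAlgebra.spectralOrder F
  have : StarOrderedRing F := CStarAlgebra.spectralOrderedRing F
  let e : FreeAlgebra ℂ A →ₐ[ℂ] F := L.codRestrict F.toSubalgebra hLF
  have he : ∀ x, (e x : P) = L x := fun x => rfl
  let η' : A →ₗ[ℂ] F :=
    { toFun := fun a => ⟨η a, hL a ▸ hLF _⟩
      map_add' := fun a b => Subtype.ext (map_add η a b)
      map_smul' := fun a b => Subtype.ext (map_smul η a b) }
  have heη : ∀ a, e (FreeAlgebra.ι ℂ a) = η' a := fun a => Subtype.ext (hL a)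
  have hstar' : ∀ a, star (η' a) = η' (star a) := fun a => Subtype.ext (hstar a).symm
  have hdense : DenseRange e := by
    intro y
    rw [closure_subtype]
    have hy : (y : P) ∈ closure (S : Set P) := y.2
    refine closure_mono ?_ hy
    rintro _ ⟨x, rfl⟩
    exact ⟨e x, ⟨x, rfl⟩, rfl⟩
  have hpos' : ∀ a, 0 ≤ a → 0 ≤ η' a := fun a ha =>
    (nonneg_iff_norm (show ‖η' a‖ ≤ 4 * ‖a‖ from hbd a)).2
      ⟨by rw [IsSelfAdjoint, hstar', (IsSelfAdjoint.of_nonneg ha).star_eq], hpos a ha⟩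
  refine ⟨F, inferInstance, inferInstance, inferInstance, η', ⟨?_, hpos'⟩, ?_⟩
  · rw [← sub_nonneg]
    refine (nonneg_iff_norm (show ‖1 - η' 1‖ ≤ 5 from hone')).2 ⟨?_, hone⟩
    rw [IsSelfAdjoint, star_sub, star_one, hstar', star_one]
  · intro B _ _ _ f hf
    let g := FreeAlgebra.lift ℂ (f : A → B)
    have hg : ∀ a, g (FreeAlgebra.ι ℂ a) = f a := fun a => by simp [g]
    let h0 : F →L[ℂ] B := g.toLinearMap.extendOfNorm e.toLinearMap
    have h0e : ∀ x, h0 (e x) = g x := fun x =>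
      LinearMap.extendOfNorm_eq (f := g.toLinearMap) (e := e.toLinearMap) hdense
        ⟨1, fun x => by rw [one_mul]; exact huniv B f hf x⟩ x
    have h0c : Continuous h0 := h0.continuous
    have hmul : ∀ x y, h0 (x * y) = h0 x * h0 y := by
      intro x y
      refine hdense.induction_on₂ (p := fun x y => h0 (x * y) = h0 x * h0 y)
        (isClosed_eq (by fun_prop) (by fun_prop)) ?_ x y
      intro a b
      rw [← map_mul, h0e, h0e, h0e, map_mul]
    have h01 : h0 1 = 1 := by rw [← map_one e, h0e, map_one]
    have hs : ∀ x, h0 (star x) = star (h0 x) := by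
      intro x
      refine hdense.induction_on (p := fun x => h0 (star x) = star (h0 x)) x
        (isClosed_eq (by fun_prop) (by fun_prop)) ?_
      intro a
      induction a using FreeAlgebra.induction with
      | grade0 r =>
        rw [AlgHom.commutes, ← algebraMap_star_comm, Algebra.algebraMap_eq_smul_one,
          Algebra.algebraMap_eq_smul_one, map_smul, map_smul, h01, star_smul, star_one]
      | grade1 a => rw [heη, hstar', ← heη, ← heη, h0e, h0e, hg, hg, map_star' f hf]
      | mul a b ha hb => rw [map_mul, star_mul, hmul, hmul, ha, hb, star_mul]
      | add a b ha hb => rw [map_add, star_add, map_add, map_add, ha, hb, star_add]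
    let h : F →⋆ₐ[ℂ] B :=
      { toFun := h0
        map_one' := h01
        map_mul' := hmul
        map_zero' := map_zero h0
        map_add' := map_add h0
        commutes' := fun r => by
          rw [Algebra.algebraMap_eq_smul_one, Algebra.algebraMap_eq_smul_one, map_smul, h01]
        map_star' := hs }
    refine ⟨h, fun a => ?_, fun k hk => ?_⟩
    · change h0 (η' a) = f a
      rw [← heη, h0e, hg]
    · have hkc : Continuous k := map_continuous k
      have : (k : F →ₐ[ℂ] B).comp e = g := by
        ext a
        simp [heη, hk, hg]
      refine DFunLike.coe_injective (hdense.equalizer hkc h0c ?_)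
      funext x
      change k (e x) = h0 (e x)
      rw [h0e, ← this]
      rfl
end
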